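/- Let U : ℝ³ → ℝ³ be a real-valued ℤ³-periodic trigonometric polynomial with zero mean (Û(0) = 0). For an integer n ≥ 2, define the 3×3 complex matrix α⁽ⁿ⁾ by α⁽ⁿ⁾ b = ∑ Û(k_n) × ( (i m_{n−1}/(2π|m_{n−1}|²)) × ( Û(k_{n−1}) × ( ⋯ ( (i m₁/(2π|m₁|²)) × ( Û(k₁) × b ) ) ⋯ ) ) ), where the sum runs over all tuples (k₁,…,k_n) ∈ (ℤ³)ⁿ with k₁ + ⋯ + k_n = 0 such that every partial sum m_i = k₁ + ⋯ + k_i (1 ≤ i ≤ n−1) is nonzero. Then α⁽ⁿ⁾ is a real matrix and has the same parity as n: its transpose satisfies (α⁽ⁿ⁾)ᵀ = (−1)ⁿ α⁽ⁿ⁾. In particular α⁽²⁾ is a real symmetric matrix. -/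

import Mathlib

open Matrix MeasureTheory Real

/-- Fourier coefficient at `k ∈ ℤ³` of a `ℤ³`-periodic function `W : ℝ³ → ℂ³`. -/
noncomputable def fourierCoef (W : (Fin 3 → ℝ) → Fin 3 → ℂ) (k : Fin 3 → ℤ) :
    Fin 3 → ℂ := fun c =>
  ∫ θ in Set.Icc (0 : Fin 3 → ℝ) 1,
    Complex.exp (-(2 * Real.pi * Complex.I) * (∑ i, (k i : ℂ) * (θ i : ℂ))) * W θ c

/-- Fourier coefficient of a real-valued field. -/
noncomputable def fourierCoefR (W : (Fin 3 → ℝ) → Fin 3 → ℝ) (k : Fin 3 → ℤ) :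
    Fin 3 → ℂ := fourierCoef (fun θ c => ((W θ c : ℝ) : ℂ)) k

/-- The vector `i m / (2π |m|²) ∈ ℂ³` for `m ∈ ℤ³`. -/
noncomputable def imOver2PiNormSq (m : Fin 3 → ℤ) : Fin 3 → ℂ := fun i =>
  Complex.I * (m i : ℂ) / ((2 * Real.pi * (∑ l, ((m l : ℝ)) ^ 2) : ℝ) : ℂ)

/-- The nested cross product
`Û(kₙ) × ((i m_{n−1}/(2π|m_{n−1}|²)) × (Û(k_{n−1}) × (⋯ ((i m₁/(2π|m₁|²)) × (Û(k₁) × b)) ⋯)))`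
built from the list `[k₁, …, kₙ]`; the second argument is the accumulated partial sum. -/
noncomputable def nestTerm (U : (Fin 3 → ℝ) → Fin 3 → ℝ) :
    List (Fin 3 → ℤ) → (Fin 3 → ℤ) → (Fin 3 → ℂ) → Fin 3 → ℂ
  | [], _, b => b
  | [k], _, b => crossProduct (fourierCoefR U k) b
  | k :: k' :: ks, s, b =>
      nestTerm U (k' :: ks) (s + k)
        (crossProduct (imOver2PiNormSq (s + k)) (crossProduct (fourierCoefR U k) b))

/-- The map `b ↦ α⁽ⁿ⁾ b`, summing `nestTerm` over all tuples `(k₁,…,kₙ)` with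
`k₁ + ⋯ + kₙ = 0` whose partial sums `m_i = k₁ + ⋯ + k_i` (`1 ≤ i ≤ n−1`) are all nonzero. -/
noncomputable def alphaN (U : (Fin 3 → ℝ) → Fin 3 → ℝ) (n : ℕ) (b : Fin 3 → ℂ) :
    Fin 3 → ℂ :=
  ∑ᶠ (k : Fin n → Fin 3 → ℤ)
    (_ : (∑ i, k i = 0) ∧
      ∀ i : Fin n, (i : ℕ) + 1 < n →
        (∑ l ∈ Finset.univ.filter (fun l : Fin n => l ≤ i), k l) ≠ 0),
    nestTerm U (List.ofFn k) 0 b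

/-- The matrix of `α⁽ⁿ⁾` in the canonical basis. -/
noncomputable def alphaNMat (U : (Fin 3 → ℝ) → Fin 3 → ℝ) (n : ℕ) :
    Matrix (Fin 3) (Fin 3) ℂ :=
  Matrix.of fun l m => alphaN U n (Pi.single m 1) l

lemma fourierCoefR_neg (U : (Fin 3 → ℝ) → Fin 3 → ℝ) (k : Fin 3 → ℤ) :
    fourierCoefR U (-k) = star (fourierCoefR U k) := by
  funext c
  simp only [fourierCoefR, fourierCoef, Pi.star_apply, RCLike.star_def, ← integral_conj]
  congr 1
  funext θ
  simp [← Complex.exp_conj, Complex.conj_ofNat]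

lemma imOver2PiNormSq_neg (m : Fin 3 → ℤ) :
    imOver2PiNormSq (-m) = -imOver2PiNormSq m := by
  funext i
  simp [imOver2PiNormSq, neg_div]

lemma star_imOver2PiNormSq (m : Fin 3 → ℤ) :
    star (imOver2PiNormSq m) = imOver2PiNormSq (-m) := by
  funext i
  simp [imOver2PiNormSq]

lemma star_crossProduct (v w : Fin 3 → ℂ) :
    star (crossProduct v w) = crossProduct (star v) (star w) := by
  funext i
  fin_cases i <;> simp [cross_apply]

lemma dotProduct_crossProduct_swap (c v w : Fin 3 → ℂ) :
    c ⬝ᵥ crossProduct v w = -(crossProduct v c ⬝ᵥ w) := by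
  simp only [cross_apply, dotProduct, Fin.sum_univ_three, cons_val]
  ring

lemma nestTerm_zero (U : (Fin 3 → ℝ) → Fin 3 → ℝ) (L : List (Fin 3 → ℤ)) (s : Fin 3 → ℤ) :
    nestTerm U L s 0 = 0 := by
  induction L generalizing s with
  | nil => rfl
  | cons k L ih =>
    cases L with
    | nil => simp [nestTerm]
    | cons k' L => simp [nestTerm, ih]

lemma nestTerm_eq_zero_of_mem (U : (Fin 3 → ℝ) → Fin 3 → ℝ) {k : Fin 3 → ℤ}
    (hk : fourierCoefR U k = 0) (L : List (Fin 3 → ℤ)) (hL : k ∈ L) (s : Fin 3 → ℤ)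
    (b : Fin 3 → ℂ) : nestTerm U L s b = 0 := by
  induction L generalizing s b with
  | nil => simp at hL
  | cons a L ih =>
    rcases List.mem_cons.1 hL with rfl | h
    · cases L with
      | nil => simp [nestTerm, hk]
      | cons k' L => simp [nestTerm, hk, nestTerm_zero]
    · cases L with
      | nil => simp at h
      | cons k' L => rw [nestTerm]; exact ih h _ _

lemma nestTerm_concat (U : (Fin 3 → ℝ) → Fin 3 → ℝ) (L : List (Fin 3 → ℤ)) (hL : L ≠ [])
    (k s : Fin 3 → ℤ) (b : Fin 3 → ℂ) :
    nestTerm U (L ++ [k]) s b = crossProduct (fourierCoefR U k)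
      (crossProduct (imOver2PiNormSq (s + L.sum)) (nestTerm U L s b)) := by
  induction L generalizing s b with
  | nil => exact absurd rfl hL
  | cons a L ih =>
    cases L with
    | nil => simp [nestTerm]
    | cons k' L =>
      have := ih (by simp) (s + a)
        (crossProduct (imOver2PiNormSq (s + a)) (crossProduct (fourierCoefR U a) b))
      simp only [List.cons_append, List.sum_cons, nestTerm] at this ⊢
      rw [this, add_assoc s a]

/-- Reversing the tuple of wave vectors gives the adjoint, up to a sign. -/
lemma dotProduct_nestTerm (U : (Fin 3 → ℝ) → Fin 3 → ℝ) (L : List (Fin 3 → ℤ)) (hL : L ≠ [])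
    (s : Fin 3 → ℤ) (b c : Fin 3 → ℂ) :
    c ⬝ᵥ nestTerm U L s b
      = (-1) ^ L.length * (nestTerm U L.reverse (-(s + L.sum)) c ⬝ᵥ b) := by
  induction L generalizing s b with
  | nil => exact absurd rfl hL
  | cons a L ih =>
    cases L with
    | nil => simp [nestTerm, dotProduct_crossProduct_swap c]
    | cons k' L =>
      rw [nestTerm, ih (by simp), List.reverse_cons (a := a), nestTerm_concat _ _ (by simp),
        dotProduct_crossProduct_swap, dotProduct_crossProduct_swap]
      have h₁ : -(s + (a :: k' :: L).sum) + (k' :: L).reverse.sum = -(s + a) := by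
        rw [List.sum_reverse, List.sum_cons (a := a)]
        abel
      rw [h₁, imOver2PiNormSq_neg, List.sum_cons (a := a), ← add_assoc s a]
      simp only [map_neg, LinearMap.neg_apply, neg_dotProduct, List.length_cons, pow_succ]
      ring

lemma star_nestTerm (U : (Fin 3 → ℝ) → Fin 3 → ℝ) (L : List (Fin 3 → ℤ)) (s : Fin 3 → ℤ)
    (b : Fin 3 → ℂ) :
    star (nestTerm U L s b) = nestTerm U (L.map Neg.neg) (-s) (star b) := by
  induction L generalizing s b with
  | nil => rfl
  | cons a L ih =>
    cases L with
    | nil => simp [nestTerm, star_crossProduct, fourierCoefR_neg]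
    | cons k' L =>
      rw [nestTerm, ih]
      simp only [List.map_cons, nestTerm, star_crossProduct, fourierCoefR_neg,
        star_imOver2PiNormSq, neg_add]

/-- The character `e^{2πi m·θ}` has zero mean for `m ≠ 0`. -/
lemma integral_exp_two_pi_eq_zero (m : Fin 3 → ℤ) (hm : m ≠ 0) :
    ∫ θ in Set.Icc (0 : Fin 3 → ℝ) 1,
      Complex.exp (2 * Real.pi * Complex.I * (∑ i, (m i : ℂ) * (θ i : ℂ))) = 0 := by
  obtain ⟨j, hj⟩ := Function.ne_iff.1 hm
  simp only [Finset.mul_sum, Complex.exp_sum]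
  rw [← Set.pi_univ_Icc, volume_pi, Measure.restrict_pi_pi,
    integral_fintype_prod_eq_prod
      (fun i (x : ℝ) => Complex.exp (2 * Real.pi * Complex.I * ((m i : ℂ) * (x : ℂ))))]
  refine Finset.prod_eq_zero (Finset.mem_univ j) ?_
  have hc : (2 * Real.pi * Complex.I * (m j : ℂ)) ≠ 0 :=
    mul_ne_zero Complex.two_pi_I_ne_zero (by exact_mod_cast hj)
  have h1 : Complex.exp (2 * Real.pi * Complex.I * (m j : ℂ)) = 1 :=
    Complex.exp_eq_one_iff.2 ⟨m j, by ring⟩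
  simp only [← mul_assoc, Pi.zero_apply, Pi.one_apply]
  rw [integral_Icc_eq_integral_Ioc, ← intervalIntegral.integral_of_le zero_le_one,
    integral_exp_mul_complex hc]
  simp [h1]

lemma finite_support_fourierCoefR (U : (Fin 3 → ℝ) → Fin 3 → ℝ)
    (hUpoly : ∃ c : (Fin 3 → ℤ) → Fin 3 → ℂ, (Function.support c).Finite ∧
      ∀ θ m, ((U θ m : ℝ) : ℂ) = ∑ᶠ k : Fin 3 → ℤ,
        c k m * Complex.exp (2 * Real.pi * Complex.I * (∑ i, (k i : ℂ) * (θ i : ℂ)))) :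
    (Function.support (fourierCoefR U)).Finite := by
  obtain ⟨c, hc, hU⟩ := hUpoly
  refine hc.subset fun k hk => ?_
  by_contra hck
  refine hk (funext fun m => ?_)
  have hU' : ∀ θ, ((U θ m : ℝ) : ℂ) = ∑ j ∈ hc.toFinset,
      c j m * Complex.exp (2 * Real.pi * Complex.I * (∑ i, (j i : ℂ) * (θ i : ℂ))) := by
    intro θ
    rw [hU]
    refine finsum_eq_sum_of_support_subset _ fun j hj => ?_
    simp only [Set.Finite.coe_toFinset, Function.mem_support] at hj ⊢
    rintro h
    simp [h] at hj
  have hexp : ∀ (θ : Fin 3 → ℝ) (j : Fin 3 → ℤ),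
      Complex.exp (-(2 * Real.pi * Complex.I) * (∑ i, (k i : ℂ) * (θ i : ℂ))) *
        (c j m * Complex.exp (2 * Real.pi * Complex.I * (∑ i, (j i : ℂ) * (θ i : ℂ))))
      = c j m * Complex.exp (2 * Real.pi * Complex.I *
          (∑ i, (((j - k) i : ℤ) : ℂ) * (θ i : ℂ))) := by
    intro θ j
    rw [mul_left_comm, ← Complex.exp_add]
    congr 2
    simp only [Fin.sum_univ_three, Pi.sub_apply, Int.cast_sub]
    ring
  simp only [fourierCoefR, fourierCoef, hU', Finset.mul_sum hc.toFinset, hexp, Pi.zero_apply]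
  rw [integral_finsetSum]
  · refine Finset.sum_eq_zero fun j hj => ?_
    rw [integral_const_mul, integral_exp_two_pi_eq_zero, mul_zero]
    rw [sub_ne_zero]
    rintro rfl
    simp [hck] at hj
  · intro j _
    refine Continuous.integrableOn_Icc ?_
    fun_prop

/-- The tuples of wave vectors over which `alphaN` sums. -/
def admissibleTuples (n : ℕ) : Set (Fin n → Fin 3 → ℤ) :=
  {k | (∑ i, k i = 0) ∧ ∀ i : Fin n, (i : ℕ) + 1 < n →
    (∑ l ∈ Finset.univ.filter (fun l : Fin n => l ≤ i), k l) ≠ 0}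

lemma neg_mem_admissibleTuples {n : ℕ} {k : Fin n → Fin 3 → ℤ} :
    -k ∈ admissibleTuples n ↔ k ∈ admissibleTuples n := by
  simp [admissibleTuples]

lemma comp_rev_mem_admissibleTuples {n : ℕ} {k : Fin n → Fin 3 → ℤ}
    (hk : k ∈ admissibleTuples n) : k ∘ Fin.rev ∈ admissibleTuples n := by
  obtain ⟨h₀, h⟩ := hk
  refine ⟨by rw [← h₀]; exact Equiv.sum_comp Fin.revPerm k, fun i hi hs => ?_⟩
  refine h ⟨n - 2 - i, by omega⟩ (by simp only; omega) ?_
  rw [← Finset.sum_filter_add_sum_filter_not _ (fun l : Fin n => l ≤ ⟨n - 2 - i, by omega⟩)]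
    at h₀
  rw [← h₀, left_eq_add, ← hs]
  refine Finset.sum_equiv Fin.revPerm (fun l => ?_) (fun l _ => by simp)
  simp only [Finset.mem_filter, Finset.mem_univ, true_and, Fin.le_def, Fin.revPerm_apply,
    Fin.val_rev]
  omega

lemma comp_rev_mem_admissibleTuples_iff {n : ℕ} {k : Fin n → Fin 3 → ℤ} :
    k ∘ Fin.rev ∈ admissibleTuples n ↔ k ∈ admissibleTuples n := by
  refine ⟨fun h => ?_, comp_rev_mem_admissibleTuples⟩
  have := comp_rev_mem_admissibleTuples h
  rwa [Function.comp_assoc, Fin.rev_involutive.comp_self, Function.comp_id] at this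

lemma ofFn_comp_rev {α : Type*} {n : ℕ} (f : Fin n → α) :
    List.ofFn (f ∘ Fin.rev) = (List.ofFn f).reverse := by
  refine List.ext_getElem (by simp) fun i h₁ h₂ => ?_
  simp only [List.length_ofFn] at h₁
  simp only [List.getElem_ofFn, List.getElem_reverse, Function.comp_apply, List.length_ofFn]
  congr 1
  ext
  simp only [Fin.val_rev]
  omega

/-- Entrywise form of `alphaNMat`. -/
lemma alphaNMat_apply (U : (Fin 3 → ℝ) → Fin 3 → ℝ)
    (hfin : (Function.support (fourierCoefR U)).Finite) (n : ℕ) (l m : Fin 3) :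
    alphaNMat U n l m = ∑ᶠ k, (admissibleTuples n).indicator
      (fun k => nestTerm U (List.ofFn k) 0 (Pi.single m 1) l) k := by
  have h : alphaNMat U n l m = (∑ᶠ k, (admissibleTuples n).indicator
      (fun k => nestTerm U (List.ofFn k) 0 (Pi.single m 1)) k) l := by
    rw [← finsum_mem_def]
    rfl
  rw [h, finsum_apply]
  · refine finsum_congr fun k => ?_
    by_cases hk : k ∈ admissibleTuples n <;> simp [hk]
  · refine (Set.Finite.pi' (t := fun _ : Fin n => Function.support (fourierCoefR U))
      fun _ => hfin).subset fun k hk i hi => hk ?_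
    by_cases hk' : k ∈ admissibleTuples n
    · rw [Set.indicator_of_mem hk', nestTerm_eq_zero_of_mem U hi]
      simp
    · rw [Set.indicator_of_notMem hk']

/-- for a real-valued zero-mean trigonometric polynomial `U` and `n ≥ 2`,
the matrix `α⁽ⁿ⁾` is real and `(α⁽ⁿ⁾)ᵀ = (−1)ⁿ α⁽ⁿ⁾`; in particular `α⁽²⁾` is a real
symmetric matrix. -/
theorem stmt11 (U : (Fin 3 → ℝ) → Fin 3 → ℝ)
    (hUpoly : ∃ c : (Fin 3 → ℤ) → Fin 3 → ℂ, (Function.support c).Finite ∧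
      ∀ θ m, ((U θ m : ℝ) : ℂ) = ∑ᶠ k : Fin 3 → ℤ,
        c k m * Complex.exp (2 * Real.pi * Complex.I * (∑ i, (k i : ℂ) * (θ i : ℂ))))
    (hmean : fourierCoefR U 0 = 0)
    (n : ℕ) (hn : 2 ≤ n) :
    (∀ l m, (alphaNMat U n l m).im = 0) ∧
    (alphaNMat U n)ᵀ = ((-1 : ℂ) ^ n) • alphaNMat U n := by
  have hfin := finite_support_fourierCoefR U hUpoly
  constructor
  · intro l m
    rw [← Complex.conj_eq_iff_im, alphaNMat_apply U hfin]
    change (starRingAut : ℂ ≃+* ℂ).toAddEquiv _ = _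
    rw [AddEquiv.map_finsum, ← finsum_comp_equiv (Equiv.neg _)]
    refine finsum_congr fun k => ?_
    by_cases hk : k ∈ admissibleTuples n
    · have h := congrFun (star_nestTerm U (List.ofFn (-k)) 0 (Pi.single m 1)) l
      have h₁ : (List.ofFn (-k)).map Neg.neg = List.ofFn k := by
        rw [List.map_ofFn]
        congr 1
        funext i
        simp
      have h₂ : star (Pi.single m 1 : Fin 3 → ℂ) = Pi.single m 1 := by
        rw [← Pi.single_star, star_one]
      rw [h₁, h₂, neg_zero] at h
      rw [Set.indicator_of_mem hk, ← h, Equiv.neg_apply,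
        Set.indicator_of_mem (neg_mem_admissibleTuples.2 hk)]
      rfl
    · rw [Set.indicator_of_notMem hk, Equiv.neg_apply,
        Set.indicator_of_notMem (mt neg_mem_admissibleTuples.1 hk), map_zero]
  · ext l m
    rw [transpose_apply, Matrix.smul_apply, alphaNMat_apply U hfin, alphaNMat_apply U hfin,
      smul_finsum, ← finsum_comp_equiv (Fin.revPerm.arrowCongr (Equiv.refl _))]
    refine finsum_congr fun k => ?_
    change (admissibleTuples n).indicator _ (k ∘ Fin.rev) = _
    by_cases hk : k ∈ admissibleTuples n
    · rw [Set.indicator_of_mem hk, Set.indicator_of_mem (comp_rev_mem_admissibleTuples hk)]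
      have h := dotProduct_nestTerm U (List.ofFn k)
        (by rw [Ne, List.ofFn_eq_nil_iff]; omega) 0 (Pi.single m 1) (Pi.single l 1)
      rw [List.sum_ofFn, hk.1, add_zero, neg_zero, ← ofFn_comp_rev, List.length_ofFn,
        single_one_dotProduct, dotProduct_single_one] at h
      rw [h, smul_eq_mul, ← mul_assoc, ← mul_pow]
      simp
    · rw [Set.indicator_of_notMem hk,
        Set.indicator_of_notMem (mt comp_rev_mem_admissibleTuples_iff.1 hk), smul_zero]
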